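/- Let θ ∈ ℝ^ℓ be fixed, let μ(·,θ) : ℝ^d → ℝ^d and σ(·,θ) : ℝ^d → ℝ^{d×m} be differentiable in x, and let β > 0. Suppose that for all x₁, x₂ ∈ ℝ^d, ⟨μ(x₁,θ) − μ(x₂,θ), x₁ − x₂⟩ + (3/2)|σ(x₁,θ) − σ(x₂,θ)|² ≤ −β|x₁ − x₂|². Then for all x, y ∈ ℝ^d, ⟨(∂ₓμ(x,θ))y, y⟩ + (3/2)|(∂ₓσ(x,θ))y|² ≤ −β|y|², where ∂ₓ denotes the (Fréchet) derivative with respect to x. -/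

import Mathlib

open scoped RealInnerProductSpace

/-- Pointwise dissipativity of the derivatives `∂ₓμ` and `∂ₓσ` from
the two-point dissipativity of `μ` and `σ` (for a fixed parameter `θ`, which is
suppressed: we work with `μ(·,θ)` and `σ(·,θ)` directly). Matrices are
represented as elements of `EuclideanSpace ℝ (Fin d × Fin m)` (Frobenius norm),
and `∂ₓ` is the Fréchet derivative `fderiv ℝ`. -/
theorem derivative_dissipativity
    (d m : ℕ)
    (μ : EuclideanSpace ℝ (Fin d) → EuclideanSpace ℝ (Fin d))
    (σ : EuclideanSpace ℝ (Fin d) → EuclideanSpace ℝ (Fin d × Fin m))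
    (β : ℝ) (hβ : 0 < β)
    (hμdiff : Differentiable ℝ μ) (hσdiff : Differentiable ℝ σ)
    (hdis : ∀ x₁ x₂ : EuclideanSpace ℝ (Fin d),
      ⟪μ x₁ - μ x₂, x₁ - x₂⟫ + (3 / 2) * ‖σ x₁ - σ x₂‖ ^ 2 ≤ -β * ‖x₁ - x₂‖ ^ 2) :
    ∀ x y : EuclideanSpace ℝ (Fin d),
      ⟪fderiv ℝ μ x y, y⟫ + (3 / 2) * ‖fderiv ℝ σ x y‖ ^ 2 ≤ -β * ‖y‖ ^ 2 := by
  intro x y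
  have hμ := ((hμdiff x).hasFDerivAt.hasLineDerivAt y).tendsto_slope_zero
  have hσ := ((hσdiff x).hasFDerivAt.hasLineDerivAt y).tendsto_slope_zero
  refine le_of_tendsto ((hμ.inner tendsto_const_nhds).add ((hσ.norm.pow 2).const_mul (3 / 2))) ?_
  filter_upwards [self_mem_nhdsWithin] with t ht
  have ht : t ≠ 0 := ht
  have h := hdis (x + t • y) x
  rw [add_sub_cancel_left, real_inner_smul_right, norm_smul, mul_pow, Real.norm_eq_abs,
    sq_abs] at h
  rw [real_inner_smul_left, norm_smul, mul_pow, Real.norm_eq_abs, sq_abs]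
  calc _ = t⁻¹ ^ 2 * (t * ⟪μ (x + t • y) - μ x, y⟫ + 3 / 2 * ‖σ (x + t • y) - σ x‖ ^ 2) := by
        field_simp
    _ ≤ t⁻¹ ^ 2 * (-β * (t ^ 2 * ‖y‖ ^ 2)) := mul_le_mul_of_nonneg_left h (sq_nonneg t⁻¹)
    _ = -β * ‖y‖ ^ 2 := by field_simp
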